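/- arXiv:math/0306008 — 2 statements merged into one kernel-verified Lean document; each statement's English description precedes it below -/
import Mathlib

section
/- Euler's constant equals the iterated integral γ = ∫_0^∞ ∫_0^1 u^t(−ln u/(1−u) − 1) du dt. -/
open MeasureTheory Set Filter Topology

/-- For `0 < s`, the integrals of the terms in the expansion of
`u ^ t * (-log u / (1 - u) - 1)` as a geometric series. -/
lemma integral_rpow_mul_neg_log_sub {s : ℝ} (hs : 0 < s) :
    IntegrableOn (fun u : ℝ ↦ u ^ s * (-Real.log u - (1 - u))) (Ioo 0 1) ∧
      ∫ u in Ioo (0 : ℝ) 1, u ^ s * (-Real.log u - (1 - u)) =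
        1 / (s + 1) ^ 2 - 1 / (s + 1) + 1 / (s + 2) := by
  let F : ℝ → ℝ := fun u ↦ -(u ^ s * (u * Real.log u)) / (s + 1) +
    u ^ (s + 1) / (s + 1) ^ 2 - u ^ (s + 1) / (s + 1) + u ^ (s + 2) / (s + 2)
  have hF : ContinuousOn F (Icc 0 1) := by
    apply Continuous.continuousOn
    have h0 := Real.continuous_rpow_const hs.le
    have h1 := Real.continuous_rpow_const (by linarith : 0 ≤ s + 1)
    have h2 := Real.continuous_rpow_const (by linarith : 0 ≤ s + 2)
    have h3 := Real.continuous_mul_log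
    exact ((((h0.mul h3).neg.div_const _).add (h1.div_const _)).sub (h1.div_const _)).add
      (h2.div_const _)
  have hd : ∀ u ∈ Ioo (0 : ℝ) 1,
      HasDerivAt F (u ^ s * (-Real.log u - (1 - u))) u := by
    intro u hu
    have hu0 : u ≠ 0 := hu.1.ne'
    have h0 := Real.hasDerivAt_rpow_const (p := s) (Or.inl hu0)
    have h1 := Real.hasDerivAt_rpow_const (p := s + 1) (Or.inl hu0)
    have h2 := Real.hasDerivAt_rpow_const (p := s + 2) (Or.inl hu0)
    have h3 := Real.hasDerivAt_mul_log hu0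
    refine (((((h0.mul h3).neg.div_const (s + 1)).add (h1.div_const ((s + 1) ^ 2))).sub
      (h1.div_const (s + 1))).add (h2.div_const (s + 2))).congr_deriv ?_
    have e0 : u ^ (s - 1) = u ^ s / u := Real.rpow_sub_one hu0 s
    have e1 : u ^ (s + 1 - 1) = u ^ s := by ring_nf
    have e2 : u ^ (s + 2 - 1) = u ^ s * u := by
      rw [← Real.rpow_add_one hu0]; ring_nf
    have : s + 1 ≠ 0 := by positivity
    have : s + 2 ≠ 0 := by positivity
    rw [e0, e1, e2]
    field_simp
    ring
  have hpos : ∀ u ∈ Ioo (0 : ℝ) 1, 0 ≤ u ^ s * (-Real.log u - (1 - u)) := fun u hu ↦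
    mul_nonneg (Real.rpow_nonneg hu.1.le _) (by linarith [Real.log_le_sub_one_of_pos hu.1])
  have hint := intervalIntegral.integrableOn_deriv_of_nonneg hF hd hpos
  refine ⟨hint.mono_set Ioo_subset_Ioc_self, ?_⟩
  rw [← integral_Ioc_eq_integral_Ioo, ← intervalIntegral.integral_of_le zero_le_one,
    intervalIntegral.integral_eq_sub_of_hasDerivAt_of_le zero_le_one hF hd
      ((intervalIntegrable_iff_integrableOn_Ioc_of_le zero_le_one).2 hint)]
  have h1 : s + 1 ≠ 0 := by positivity
  have h2 : s + 2 ≠ 0 := by positivity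
  simp [F, Real.zero_rpow h1, Real.zero_rpow h2]

lemma one_div_sq_sub_one_div_add_one_div {x : ℝ} (hx : 0 < x) :
    1 / (x + 1) ^ 2 - 1 / (x + 1) + 1 / (x + 2) = 1 / ((x + 1) ^ 2 * (x + 2)) := by
  field_simp
  ring

lemma hasSum_integral_rpow_mul {t : ℝ} (ht : 0 < t) :
    HasSum (fun n : ℕ ↦ 1 / (t + n + 1) ^ 2 - 1 / (t + n + 1) + 1 / (t + n + 2))
      (∫ u in Ioo (0 : ℝ) 1, u ^ t * (-Real.log u / (1 - u) - 1)) := by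
  have hpos (n : ℕ) : 0 < t + n := by positivity
  have hnonneg (n : ℕ) : ∀ u ∈ Ioo (0 : ℝ) 1,
      0 ≤ u ^ (t + n) * (-Real.log u - (1 - u)) := fun u hu ↦
    mul_nonneg (Real.rpow_nonneg hu.1.le _) (by linarith [Real.log_le_sub_one_of_pos hu.1])
  have hsum : Summable fun n : ℕ ↦
      1 / (t + n + 1) ^ 2 - 1 / (t + n + 1) + 1 / (t + n + 2) := by
    have h := (summable_nat_add_iff 1).2 (Real.summable_one_div_nat_pow.2 one_lt_two)
    refine Summable.of_nonneg_of_le (fun n ↦ ?_) (fun n ↦ ?_) h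
    · rw [one_div_sq_sub_one_div_add_one_div (hpos n)]
      positivity
    · rw [one_div_sq_sub_one_div_add_one_div (hpos n)]
      push_cast
      apply one_div_le_one_div_of_le (by positivity)
      have h1 : ((n : ℝ) + 1) ^ 2 ≤ (t + n + 1) ^ 2 := by gcongr; linarith
      have h2 : (1 : ℝ) ≤ t + n + 2 := by linarith [hpos n]
      nlinarith [sq_nonneg (t + n + 1)]
  have key := hasSum_integral_of_summable_integral_norm
    (μ := volume.restrict (Ioo (0 : ℝ) 1))
    (F := fun (n : ℕ) u ↦ u ^ (t + n) * (-Real.log u - (1 - u)))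
    (fun n ↦ (integral_rpow_mul_neg_log_sub (hpos n)).1) (by
      refine hsum.congr fun n ↦ ?_
      rw [← (integral_rpow_mul_neg_log_sub (hpos n)).2]
      refine setIntegral_congr_fun measurableSet_Ioo fun u hu ↦ ?_
      exact (Real.norm_of_nonneg (hnonneg n u hu)).symm)
  simp_rw [fun n ↦ (integral_rpow_mul_neg_log_sub (hpos n)).2] at key
  have heq : ∫ u in Ioo (0 : ℝ) 1, ∑' n : ℕ, u ^ (t + n) * (-Real.log u - (1 - u)) =
      ∫ u in Ioo (0 : ℝ) 1, u ^ t * (-Real.log u / (1 - u) - 1) := by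
    refine setIntegral_congr_fun measurableSet_Ioo fun u hu ↦ ?_
    have h1 : 1 - u ≠ 0 := (sub_pos.2 hu.2).ne'
    have hg := ((hasSum_geometric_of_lt_one hu.1.le hu.2).mul_left (u ^ t)).mul_right
      (-Real.log u - (1 - u))
    have he : ∀ n : ℕ, u ^ t * u ^ n = u ^ (t + n) := fun n ↦
      (Real.rpow_add_natCast hu.1.ne' t n).symm
    simp_rw [he] at hg
    rw [hg.tsum_eq]
    field_simp
  rwa [heq] at key

lemma integral_Ioi_one_div_sq_sub (n : ℕ) :
    IntegrableOn (fun t : ℝ ↦ 1 / (t + n + 1) ^ 2 - 1 / (t + n + 1) + 1 / (t + n + 2))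
      (Ioi 0) ∧
    ∫ t in Ioi (0 : ℝ), (1 / (t + n + 1) ^ 2 - 1 / (t + n + 1) + 1 / (t + n + 2)) =
      1 / ((n : ℝ) + 1) - (Real.log (n + 2) - Real.log (n + 1)) := by
  let G : ℝ → ℝ := fun t ↦ -(t + n + 1)⁻¹ + Real.log (1 + (t + n + 1)⁻¹)
  have hd : ∀ t ∈ Ici (0 : ℝ), HasDerivAt G
      (1 / (t + n + 1) ^ 2 - 1 / (t + n + 1) + 1 / (t + n + 2)) t := by
    intro t ht
    have ht : 0 ≤ t := ht
    have h0 : t + n + 1 ≠ 0 := by positivity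
    have h2 : t + n + 2 ≠ 0 := by positivity
    have h1 : 1 + (t + n + 1)⁻¹ ≠ 0 := by positivity
    have hi : HasDerivAt (fun t : ℝ ↦ (t + n + 1)⁻¹) (-1 / (t + n + 1) ^ 2) t :=
      (((hasDerivAt_id t).add_const (n : ℝ)).add_const 1).inv h0
    refine (hi.neg.add ((hi.const_add 1).log h1)).congr_deriv ?_
    have e : 1 + (t + n + 1)⁻¹ = (t + n + 2) / (t + n + 1) := by
      field_simp
      ring
    rw [e]
    field_simp
    ring
  have hnonneg : ∀ t ∈ Ioi (0 : ℝ),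
      0 ≤ 1 / (t + n + 1) ^ 2 - 1 / (t + n + 1) + 1 / (t + n + 2) := by
    intro t ht
    have ht : 0 < t := ht
    rw [one_div_sq_sub_one_div_add_one_div (by positivity)]
    positivity
  have hi : Tendsto (fun t : ℝ ↦ (t + n + 1)⁻¹) atTop (𝓝 0) :=
    tendsto_inv_atTop_zero.comp
      (tendsto_atTop_add_const_right _ _ (tendsto_atTop_add_const_right _ _ tendsto_id))
  have hlim : Tendsto G atTop (𝓝 0) := by
    simpa using hi.neg.add ((hi.const_add 1).log (by norm_num))
  refine ⟨integrableOn_Ioi_deriv_of_nonneg' hd hnonneg hlim, ?_⟩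
  rw [integral_Ioi_of_hasDerivAt_of_nonneg' hd hnonneg hlim, ← Real.log_div (by positivity)
    (by positivity)]
  have e : 1 + ((n : ℝ) + 1)⁻¹ = (n + 2) / (n + 1) := by
    field_simp
    ring
  simp only [G, zero_add, e]
  ring

lemma hasSum_one_div_sub_log :
    HasSum (fun n : ℕ ↦ 1 / ((n : ℝ) + 1) - (Real.log (n + 2) - Real.log (n + 1)))
      Real.eulerMascheroniConstant := by
  rw [hasSum_iff_tendsto_nat_of_nonneg]
  · convert Real.tendsto_eulerMascheroniSeq using 2 with N
    induction N with
    | zero => simp [Real.eulerMascheroniSeq_zero]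
    | succ N ih =>
      rw [Finset.sum_range_succ, ih]
      simp only [Real.eulerMascheroniSeq, harmonic_succ]
      push_cast
      ring_nf
  · intro n
    have h := Real.log_le_sub_one_of_pos (show 0 < ((n : ℝ) + 2) / (n + 1) by positivity)
    rw [Real.log_div (by positivity) (by positivity)] at h
    have e : ((n : ℝ) + 2) / (n + 1) - 1 = 1 / (n + 1) := by
      field_simp
      ring
    linarith

theorem stmt8 :
    Real.eulerMascheroniConstant =
      ∫ t in Set.Ioi (0 : ℝ), ∫ u in Set.Ioo (0 : ℝ) 1,
        u ^ t * (-Real.log u / (1 - u) - 1) := by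
  have key := hasSum_integral_of_summable_integral_norm
    (μ := volume.restrict (Ioi (0 : ℝ)))
    (F := fun (n : ℕ) t ↦ 1 / (t + n + 1) ^ 2 - 1 / (t + n + 1) + 1 / (t + n + 2))
    (fun n ↦ (integral_Ioi_one_div_sq_sub n).1) (by
      refine hasSum_one_div_sub_log.summable.congr fun n ↦ ?_
      rw [← (integral_Ioi_one_div_sq_sub n).2]
      refine setIntegral_congr_fun measurableSet_Ioi fun t ht ↦ ?_
      have ht : 0 < t := ht
      refine (Real.norm_of_nonneg ?_).symm
      rw [one_div_sq_sub_one_div_add_one_div (by positivity)]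
      positivity)
  simp_rw [fun n ↦ (integral_Ioi_one_div_sq_sub n).2] at key
  rw [hasSum_one_div_sub_log.unique key]
  exact setIntegral_congr_fun measurableSet_Ioi fun t ht ↦ (hasSum_integral_rpow_mul ht).tsum_eq
end

section
/- Euler's constant equals the series γ = Σ_{n=1}^∞ (1/(n+1)) Σ_{k=0}^n (−1)^{k+1} C(n,k) ln(k+1). -/
open Filter Topology intervalIntegral

/-- The Beta value `B(x, n + 1) = n! / (x (x + 1) ⋯ (x + n))`. -/
noncomputable def betaNat : ℕ → ℝ → ℝ
  | 0, x => 1 / x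
  | n + 1, x => betaNat n x * ((n + 1) / (x + (n + 1)))

lemma betaNat_nonneg (n : ℕ) {x : ℝ} (hx : 0 < x) : 0 ≤ betaNat n x := by
  induction n with
  | zero => simp only [betaNat]; positivity
  | succ n ih => simp only [betaNat]; positivity

lemma betaNat_add_one (n : ℕ) {x : ℝ} (hx : 0 < x) :
    (n + 1) * betaNat n (x + 1) = x * betaNat (n + 1) x := by
  induction n with
  | zero => simp only [betaNat]; field_simp; simp
  | succ n ih =>
    have h : betaNat n (x + 1) = x * betaNat (n + 1) x / (n + 1) := by
      rw [← ih]; field_simp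
    have h1 : betaNat (n + 1) (x + 1) = betaNat n (x + 1) * ((n + 1) / (x + 1 + (n + 1))) := rfl
    have h2 : betaNat (n + 1 + 1) x =
      betaNat (n + 1) x * (((n + 1 : ℕ) + 1) / (x + ((n + 1 : ℕ) + 1))) := rfl
    rw [h1, h2, h]
    push_cast
    have : x + 1 + ((n : ℝ) + 1) = x + (n + 1 + 1) := by ring
    rw [this]
    field_simp

lemma betaNat_sub_betaNat_add_one (n : ℕ) {x : ℝ} (hx : 0 < x) :
    betaNat n x - betaNat n (x + 1) = betaNat (n + 1) x := by
  have h := betaNat_add_one n hx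
  have h' : betaNat n (x + 1) = x * betaNat (n + 1) x / (n + 1) := by rw [← h]; field_simp
  rw [h']
  simp only [betaNat]
  field_simp
  ring

lemma betaNat_one (n : ℕ) : betaNat n 1 = 1 / (n + 1) := by
  induction n with
  | zero => simp [betaNat]
  | succ n ih =>
    simp only [betaNat, ih]
    push_cast
    field_simp
    ring

lemma betaNat_anti (n : ℕ) {x y : ℝ} (hx : 0 < x) (hxy : x ≤ y) :
    betaNat n y ≤ betaNat n x := by
  induction n with
  | zero => simp only [betaNat]; gcongr
  | succ n ih =>
    have := betaNat_nonneg n hx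
    have hy : 0 < y := hx.trans_le hxy
    simp only [betaNat]
    gcongr

lemma betaNat_le_one_div (n : ℕ) {x : ℝ} (hx : 1 ≤ x) : betaNat n x ≤ 1 / (n + 1) := by
  rw [← betaNat_one]
  exact betaNat_anti n one_pos hx

lemma betaNat_le_one_div_arg (n : ℕ) {x : ℝ} (hx : 0 < x) : betaNat n x ≤ 1 / x := by
  induction n with
  | zero => simp [betaNat]
  | succ n ih =>
    have := betaNat_sub_betaNat_add_one n hx
    have := betaNat_nonneg n (by linarith : 0 < x + 1)
    linarith

lemma continuousOn_betaNat (n : ℕ) : ContinuousOn (betaNat n) (Set.Ioi 0) := by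
  induction n with
  | zero =>
    simp only [betaNat]
    exact continuousOn_const.div continuousOn_id fun x hx => (Set.mem_Ioi.mp hx).ne'
  | succ n ih =>
    simp only [betaNat]
    refine ih.mul (continuousOn_const.div (by fun_prop) fun x hx => ?_)
    have := Set.mem_Ioi.mp hx
    positivity

lemma sum_betaNat_div (N : ℕ) {x : ℝ} (hx : 0 < x) :
    ∑ n ∈ Finset.range N, betaNat (n + 1) x / (n + 1) = (1 / x - betaNat N x) / x := by
  have h (n : ℕ) : betaNat (n + 1) x / (n + 1) = (betaNat n x - betaNat (n + 1) x) / x := by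
    have h1 := betaNat_add_one n hx
    have h2 := betaNat_sub_betaNat_add_one n hx
    have h3 : betaNat n x - betaNat (n + 1) x = betaNat n (x + 1) := by linarith
    rw [h3]
    field_simp
    linarith
  simp_rw [h]
  rw [← Finset.sum_div, Finset.sum_range_sub']
  rfl

/-- The mean of `betaNat n` over `[m + 1, m + 2]`. -/
noncomputable def betaMean (n m : ℕ) : ℝ := ∫ x in (m + 1 : ℝ)..(m + 2), betaNat n x

lemma uIcc_subset_Ioi (m : ℕ) : Set.uIcc (m + 1 : ℝ) (m + 2) ⊆ Set.Ioi 0 := by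
  rw [Set.uIcc_of_le (by linarith)]
  intro x hx
  have : (0 : ℝ) ≤ m := m.cast_nonneg
  exact Set.mem_Ioi.mpr (by linarith [hx.1])

lemma intervalIntegrable_betaNat (n m : ℕ) :
    IntervalIntegrable (betaNat n) MeasureTheory.volume (m + 1 : ℝ) (m + 2) :=
  ((continuousOn_betaNat n).mono (uIcc_subset_Ioi m)).intervalIntegrable

lemma betaMean_zero (m : ℕ) :
    betaMean 0 m = Real.log ((m + 1 : ℕ) + 1) - Real.log (m + 1) := by
  have h : (0 : ℝ) < m + 1 := by positivity
  have h' : (0 : ℝ) < m + 2 := by positivity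
  simp only [betaMean, betaNat]
  rw [integral_one_div_of_pos h h', Real.log_div h'.ne' h.ne']
  push_cast
  ring_nf

lemma betaMean_sub_betaMean_succ (n m : ℕ) :
    betaMean n m - betaMean n (m + 1) = betaMean (n + 1) m := by
  have hs : betaMean n (m + 1) = ∫ x in (m + 1 : ℝ)..(m + 2), betaNat n (x + 1) := by
    rw [integral_comp_add_right, betaMean]
    push_cast
    ring_nf
  have hi : IntervalIntegrable (fun x => betaNat n (x + 1)) MeasureTheory.volume
      (m + 1 : ℝ) (m + 2) := by
    refine ContinuousOn.intervalIntegrable ((continuousOn_betaNat n).comp (by fun_prop) ?_)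
    intro x hx
    have := uIcc_subset_Ioi m hx
    simp only [Set.mem_Ioi] at this ⊢
    linarith
  rw [hs, betaMean, ← integral_sub (intervalIntegrable_betaNat n m) hi]
  refine integral_congr fun x hx => ?_
  exact betaNat_sub_betaNat_add_one n (uIcc_subset_Ioi m hx)

lemma betaMean_nonneg (n m : ℕ) : 0 ≤ betaMean n m := by
  refine integral_nonneg (by linarith) fun x hx => betaNat_nonneg n ?_
  exact uIcc_subset_Ioi m (Set.Icc_subset_uIcc hx)

lemma betaMean_le (n m : ℕ) : betaMean n m ≤ betaNat n (m + 1) := by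
  have h : betaMean n m ≤ ∫ _ in (m + 1 : ℝ)..(m + 2), betaNat n (m + 1) :=
    integral_mono_on (by linarith) (intervalIntegrable_betaNat n m) (by simp)
      fun x hx => betaNat_anti n (by positivity) hx.1
  refine h.trans_eq ?_
  rw [integral_const, smul_eq_mul]
  ring

lemma betaMean_le_one_div (n m : ℕ) : betaMean n m ≤ 1 / (n + 1) :=
  (betaMean_le n m).trans <| betaNat_le_one_div n <| by simp

lemma tendsto_betaMean (n : ℕ) : Tendsto (betaMean n) atTop (𝓝 0) :=
  squeeze_zero (betaMean_nonneg n)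
    (fun m => (betaMean_le n m).trans (betaNat_le_one_div_arg n (by positivity)))
    tendsto_one_div_add_atTop_nhds_zero_nat

lemma summable_one_div_succ_sq : Summable fun n : ℕ => 1 / ((n : ℝ) + 1) ^ 2 := by
  have := (summable_nat_add_iff 1).mpr (Real.summable_one_div_nat_pow.mpr one_lt_two)
  simpa using this

lemma betaMean_div_le {n m : ℕ} {c : ℝ} (hc : n + 1 ≤ c) :
    ‖betaMean n m / c‖ ≤ 1 / ((n : ℝ) + 1) ^ 2 := by
  have h : (0 : ℝ) < n + 1 := by positivity
  rw [Real.norm_of_nonneg (div_nonneg (betaMean_nonneg n m) (h.le.trans hc))]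
  calc betaMean n m / c ≤ (1 / (n + 1)) / (n + 1) := by
        gcongr
        exact betaMean_le_one_div n m
    _ = _ := by field_simp

lemma summable_betaMean_div (m : ℕ) {c : ℕ → ℝ} (hc : ∀ n : ℕ, n + 1 ≤ c n) :
    Summable fun n => betaMean n m / c n :=
  .of_norm_bounded summable_one_div_succ_sq fun n => betaMean_div_le (hc n)

lemma tendsto_tsum_betaMean_div {c : ℕ → ℝ} (hc : ∀ n : ℕ, n + 1 ≤ c n) :
    Tendsto (fun m => ∑' n, betaMean n m / c n) atTop (𝓝 0) := by
  have := tendsto_tsum_of_dominated_convergence (𝓕 := atTop)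
    (f := fun m n => betaMean n m / c n) (g := fun _ => 0) summable_one_div_succ_sq
    (fun n => by simpa using (tendsto_betaMean n).div_const (c n))
    (.of_forall fun m n => betaMean_div_le (hc n))
  simpa using this

lemma tsum_betaMean_div_sub (m : ℕ) {c : ℕ → ℝ} (hc : ∀ n : ℕ, n + 1 ≤ c n) :
    ∑' n, betaMean n m / c n - ∑' n, betaMean n (m + 1) / c n =
      ∑' n, betaMean (n + 1) m / c n := by
  rw [← (summable_betaMean_div m hc).tsum_sub (summable_betaMean_div (m + 1) hc)]
  simp_rw [← sub_div, betaMean_sub_betaMean_succ]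

lemma summable_betaMean_succ_div (m : ℕ) :
    Summable fun n : ℕ => betaMean (n + 1) m / ((n : ℝ) + 1) := by
  have h (n : ℕ) : (n : ℝ) + 1 ≤ n + 1 := le_rfl
  refine ((summable_betaMean_div m h).sub (summable_betaMean_div (m + 1) h)).congr fun n => ?_
  rw [← sub_div, betaMean_sub_betaMean_succ]

lemma sum_betaMean_succ_div (m N : ℕ) :
    ∑ n ∈ Finset.range N, betaMean (n + 1) m / ((n : ℝ) + 1) =
      1 / (m + 1 : ℝ) - 1 / (m + 2) - ∫ x in (m + 1 : ℝ)..(m + 2), betaNat N x / x := by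
  have h0 : (0 : ℝ) ∉ Set.uIcc (m + 1 : ℝ) (m + 2) := fun h =>
    lt_irrefl _ (Set.mem_Ioi.mp (uIcc_subset_Ioi m h))
  have hinv : ∫ x in (m + 1 : ℝ)..(m + 2), x ^ (-2 : ℤ) = 1 / (m + 1 : ℝ) - 1 / (m + 2) := by
    rw [integral_zpow (Or.inr ⟨by norm_num, h0⟩)]
    norm_num
    ring
  have hc : ContinuousOn (fun x : ℝ => x ^ (-2 : ℤ)) (Set.uIcc (m + 1 : ℝ) (m + 2)) :=
    fun x hx => (continuousAt_zpow₀ x _ (.inl (uIcc_subset_Ioi m hx).ne')).continuousWithinAt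
  have hb : ContinuousOn (fun x => betaNat N x / x) (Set.uIcc (m + 1 : ℝ) (m + 2)) :=
    ((continuousOn_betaNat N).mono (uIcc_subset_Ioi m)).div continuousOn_id
      fun x hx => (uIcc_subset_Ioi m hx).ne'
  rw [← hinv, ← integral_sub hc.intervalIntegrable hb.intervalIntegrable]
  simp_rw [betaMean, ← integral_div]
  rw [← integral_finsetSum fun n _ => (intervalIntegrable_betaNat (n + 1) m).div_const _]
  refine integral_congr fun x hx => ?_
  have hx' : 0 < x := uIcc_subset_Ioi m hx
  rw [sum_betaNat_div N hx', zpow_neg]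
  norm_cast
  field_simp

lemma tendsto_integral_betaNat_div (m : ℕ) :
    Tendsto (fun N => ∫ x in (m + 1 : ℝ)..(m + 2), betaNat N x / x) atTop (𝓝 0) := by
  refine squeeze_zero_norm (fun N => ?_) tendsto_one_div_add_atTop_nhds_zero_nat
  have := norm_integral_le_of_norm_le_const (a := (m + 1 : ℝ)) (b := m + 2)
    (f := fun x => betaNat N x / x) (C := 1 / ((N : ℝ) + 1)) fun x hx => by
      rw [Set.uIoc_of_le (by linarith)] at hx
      have hm : (0 : ℝ) ≤ m := m.cast_nonneg
      have hx1 : 1 ≤ x := by linarith [hx.1]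
      have hx0 : 0 < x := by linarith
      have hb := betaNat_nonneg N hx0
      rw [Real.norm_of_nonneg (by positivity)]
      exact (div_le_self hb hx1).trans (betaNat_le_one_div N hx1)
  refine this.trans_eq ?_
  norm_num

lemma tsum_betaMean_succ_div (m : ℕ) :
    ∑' n : ℕ, betaMean (n + 1) m / ((n : ℝ) + 1) = 1 / (m + 1 : ℝ) - 1 / (m + 2) := by
  refine tendsto_nhds_unique (summable_betaMean_succ_div m).hasSum.tendsto_sum_nat ?_
  simp_rw [sum_betaMean_succ_div]
  simpa using (tendsto_integral_betaNat_div m).const_sub (1 / (m + 1 : ℝ) - 1 / (m + 2))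

lemma tsum_betaMean_div_add_one (m : ℕ) :
    ∑' n : ℕ, betaMean n m / ((n : ℝ) + 1) = 1 / (m + 1 : ℝ) := by
  have hle (n : ℕ) : (n : ℝ) + 1 ≤ n + 1 := le_rfl
  set F : ℕ → ℝ := fun k => ∑' n : ℕ, betaMean n k / ((n : ℝ) + 1) - 1 / (k + 1 : ℝ) with hF
  have hstep (k : ℕ) : F (k + 1) = F k := by
    have h := tsum_betaMean_div_sub k hle
    rw [tsum_betaMean_succ_div] at h
    simp only [hF]
    push_cast
    rw [show (k : ℝ) + 1 + 1 = k + 2 by ring]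
    linarith
  have hconst (k : ℕ) : F k = F 0 := by
    induction k with
    | zero => rfl
    | succ k ih => rw [hstep, ih]
  have hlim : Tendsto F atTop (𝓝 0) := by
    simpa [hF] using (tendsto_tsum_betaMean_div hle).sub tendsto_one_div_add_atTop_nhds_zero_nat
  have h0 : F m = 0 := by
    rw [hconst m]
    refine tendsto_nhds_unique (tendsto_const_nhds.congr fun k => (hconst k).symm) hlim
  exact sub_eq_zero.mp h0

lemma tsum_betaMean_div_add_two_sub (m : ℕ) :
    ∑' n : ℕ, betaMean n m / ((n : ℝ) + 2) - ∑' n : ℕ, betaMean n (m + 1) / ((n : ℝ) + 2) =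
      1 / (m + 1 : ℝ) - betaMean 0 m := by
  rw [tsum_betaMean_div_sub m fun n => by linarith, ← tsum_betaMean_div_add_one,
    (summable_betaMean_div m fun n => le_rfl).tsum_eq_zero_add]
  simp [add_assoc, one_add_one_eq_two]

lemma tsum_betaMean_div_add_two :
    ∑' n : ℕ, betaMean n 0 / ((n : ℝ) + 2) = Real.eulerMascheroniConstant := by
  set T : ℕ → ℝ := fun m => ∑' n : ℕ, betaMean n m / ((n : ℝ) + 2) with hT
  have h (M : ℕ) : T 0 - T M = Real.eulerMascheroniSeq M := by
    rw [← Finset.sum_range_sub']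
    simp only [hT, tsum_betaMean_div_add_two_sub, betaMean_zero]
    rw [Finset.sum_sub_distrib, Finset.sum_range_sub (fun m : ℕ => Real.log (m + 1)), Real.eulerMascheroniSeq]
    simp [harmonic]
  have hlim : Tendsto T atTop (𝓝 0) := tendsto_tsum_betaMean_div fun n => by linarith
  refine tendsto_nhds_unique ?_ Real.tendsto_eulerMascheroniSeq
  simpa [h] using hlim.const_sub (T 0)

lemma betaMean_eq_fwdDiff (n m : ℕ) :
    betaMean n m = (-1) ^ n * (fwdDiff 1)^[n + 1] (fun k : ℕ => Real.log (k + 1)) m := by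
  induction n generalizing m with
  | zero => simp [betaMean_zero, fwdDiff]
  | succ n ih =>
    rw [← betaMean_sub_betaMean_succ, ih, ih, Function.iterate_succ_apply' _ (n + 1), fwdDiff]
    ring

lemma sum_choose_mul_log_eq_betaMean (n : ℕ) :
    ∑ k ∈ Finset.range (n + 2),
      (-1 : ℝ) ^ (k + 1) * ((n + 1).choose k) * Real.log (k + 1) = betaMean n 0 := by
  rw [betaMean_eq_fwdDiff, fwdDiff_iter_eq_sum_shift, Finset.mul_sum]
  refine Finset.sum_congr rfl fun k hk => ?_
  obtain ⟨j, hj⟩ := Nat.exists_eq_add_of_le (Nat.lt_succ_iff.mp (Finset.mem_range.mp hk))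
  have hs : (-1 : ℝ) ^ (k + 1) = (-1) ^ n * (-1) ^ (n + 1 - k) := by
    rw [hj, Nat.add_sub_cancel_left, ← pow_add, neg_one_pow_congr]
    grind
  rw [hs]
  simp
  ring

theorem stmt15 :
    Real.eulerMascheroniConstant =
      ∑' n : ℕ+, (1 / ((n : ℝ) + 1)) *
        ∑ k ∈ Finset.range ((n : ℕ) + 1),
          (-1 : ℝ) ^ (k + 1) * ((n : ℕ).choose k) * Real.log (k + 1) := by
  rw [← tsum_betaMean_div_add_two, ← Equiv.pnatEquivNat.symm.tsum_eq]
  refine tsum_congr fun n => ?_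
  have hn : ((Equiv.pnatEquivNat.symm n : ℕ+) : ℕ) = n + 1 := rfl
  rw [hn, sum_choose_mul_log_eq_betaMean]
  push_cast
  ring
end
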